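/- Let n ≥ 2 and let q, t be nonzero complex numbers, and let ℒ_n : B_n → GL(V) be the Lawrence–Krammer representation on the vector space V with basis {v_{j,k} : 1 ≤ j < k ≤ n}. Then the full twist Δ² = (σ₁σ₂⋯σ_{n−1})ⁿ is mapped to the scalar transformation ℒ_n(Δ²) = q^{2n} t² • id_V. -/

import Mathlib

/-- The braid relators on `m` generators: `σᵢσⱼσᵢ⁻¹σⱼ⁻¹` for `|i − j| ≥ 2` and
`σᵢσⱼσᵢ(σⱼσᵢσⱼ)⁻¹` for `|i − j| = 1`. -/
def braidRelsSet (m : ℕ) : Set (FreeGroup (Fin m)) :=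
  {r | ∃ i j : Fin m,
      (((i : ℕ) + 2 ≤ (j : ℕ) ∨ (j : ℕ) + 2 ≤ (i : ℕ)) ∧
        r = FreeGroup.of i * FreeGroup.of j * (FreeGroup.of i)⁻¹ * (FreeGroup.of j)⁻¹) ∨
      (((i : ℕ) + 1 = (j : ℕ) ∨ (j : ℕ) + 1 = (i : ℕ)) ∧
        r = FreeGroup.of i * FreeGroup.of j * FreeGroup.of i *
            (FreeGroup.of j * FreeGroup.of i * FreeGroup.of j)⁻¹)}

/-- The word `σ₁σ₂⋯σ_m` in the free group on `m` generators. -/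
def braidWord (m : ℕ) : FreeGroup (Fin m) :=
  (List.ofFn fun i : Fin m => FreeGroup.of i).prod

/-- The braid group `B_n`, presented with generators `σ₁, …, σ_{n−1}` and the
braid relations. -/
abbrev BraidGroup (n : ℕ) := PresentedGroup (braidRelsSet (n - 1))

/-- The generator `σ_{i+1}` of the braid group `B_n` (0-indexed by `i : Fin (n-1)`). -/
def braidGen (n : ℕ) (i : Fin (n - 1)) : BraidGroup n := PresentedGroup.of i

/-- The full twist `Δ² = (σ₁σ₂⋯σ_{n−1})ⁿ` in the braid group `B_n`. -/
def fullTwist (n : ℕ) : BraidGroup n :=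
  ((List.ofFn fun i : Fin (n - 1) => braidGen n i).prod) ^ n

/-- Index set for the Lawrence–Krammer representation: pairs `(j, k)` with
`1 ≤ j < k ≤ n`, encoded as elements of `Fin (n+1) × Fin (n+1)`. -/
abbrev LKIdx (n : ℕ) := {p : Fin (n + 1) × Fin (n + 1) // 1 ≤ (p.1 : ℕ) ∧ (p.1 : ℕ) < (p.2 : ℕ)}

/-- The basis vector `v_{j,k}` of the Lawrence–Krammer module (as a function). -/
def lkE (n : ℕ) (j k : ℕ) : LKIdx n → ℂ :=
  fun p => if (p.val.1 : ℕ) = j ∧ (p.val.2 : ℕ) = k then 1 else 0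

/-- The image of the basis vector `v_{j,k}` under the `i`-th Lawrence–Krammer
matrix (indices `i, j, k` are 1-based). -/
def lkF (n : ℕ) (q t : ℂ) (i j k : ℕ) : LKIdx n → ℂ :=
  if i = j ∧ i = k - 1 then (-(t * q ^ 2)) • lkE n j k
  else if i = j - 1 then q • lkE n i k + (q ^ 2 - q) • lkE n i j + (1 - q) • lkE n j k
  else if i = j then lkE n (j + 1) k
  else if i = k - 1 then q • lkE n j i + (1 - q) • lkE n j k - ((q ^ 2 - q) * t) • lkE n i k
  else if i = k then lkE n j (k + 1)
  else lkE n j k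

/-- The `i`-th Lawrence–Krammer linear endomorphism `Lᵢ` (1-based index `i`),
defined on basis vectors by `lkF`. -/
noncomputable def lkL (n : ℕ) (q t : ℂ) (i : ℕ) :
    (LKIdx n → ℂ) →ₗ[ℂ] (LKIdx n → ℂ) :=
  (Pi.basisFun ℂ (LKIdx n)).constr ℂ
    (fun p => lkF n q t i (p.val.1 : ℕ) (p.val.2 : ℕ))

/-- Partial products `s 0 * ⋯ * s (k-1)`. -/
def prodP {M : Type*} [Monoid M] (s : ℕ → M) : ℕ → M
  | 0 => 1
  | k + 1 => prodP s k * s k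

theorem prodP_ofFn {M : Type*} [Monoid M] (s : ℕ → M) (m : ℕ) :
    (List.ofFn fun i : Fin m => s i).prod = prodP s m := by
  induction m with
  | zero => simp [prodP]
  | succ k ih =>
    rw [List.ofFn_succ', List.concat_eq_append, List.prod_append]
    simp [prodP, ih]

theorem prodP_succ_left {M : Type*} [Monoid M] (s : ℕ → M) (k : ℕ) :
    prodP s (k + 1) = s 0 * prodP (fun i => s (i + 1)) k := by
  induction k with
  | zero => simp [prodP]
  | succ k ih =>
    rw [prodP, ih, mul_assoc]; rfl

theorem prodP_comm {M : Type*} [Monoid M] (s : ℕ → M) (m : ℕ)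
    (hc : ∀ i j, i + 2 ≤ j → j < m → s i * s j = s j * s i)
    (k j : ℕ) (hk : k + 1 ≤ j) (hj : j < m) :
    prodP s k * s j = s j * prodP s k := by
  induction k with
  | zero => simp [prodP]
  | succ k ih =>
    rw [prodP, mul_assoc, hc k j (by omega) hj, ← mul_assoc, ih (by omega), mul_assoc]

theorem prodP_shift {M : Type*} [Monoid M] (s : ℕ → M) (m : ℕ)
    (hc : ∀ i j, i + 2 ≤ j → j < m → s i * s j = s j * s i)
    (hb : ∀ i, i + 1 < m → s i * s (i + 1) * s i = s (i + 1) * s i * s (i + 1))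
    (i k : ℕ) (hk : i + 2 + k ≤ m) :
    prodP s (i + 2 + k) * s i = s (i + 1) * prodP s (i + 2 + k) := by
  induction k with
  | zero =>
    have h1 : prodP s (i + 2 + 0) = prodP s i * (s i * s (i + 1)) := by
      simp [prodP, mul_assoc]
    rw [h1, mul_assoc, hb i (by omega), mul_assoc, ← mul_assoc,
      prodP_comm s m hc i (i + 1) (by omega) (by omega), mul_assoc]
  | succ k ih =>
    have h1 : prodP s (i + 2 + (k + 1)) = prodP s (i + 2 + k) * s (i + 2 + k) := rfl
    rw [h1, mul_assoc, ← hc i (i + 2 + k) (by omega) (by omega), ← mul_assoc, ih (by omega),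
      mul_assoc]

theorem prodP_semi {M : Type*} [Monoid M] (s : ℕ → M) (m : ℕ)
    (hc : ∀ i j, i + 2 ≤ j → j < m → s i * s j = s j * s i)
    (hb : ∀ i, i + 1 < m → s i * s (i + 1) * s i = s (i + 1) * s i * s (i + 1))
    (i : ℕ) (hi : i + 1 < m) : SemiconjBy (prodP s m) (s i) (s (i + 1)) := by
  obtain ⟨k, rfl⟩ : ∃ k, m = i + 2 + k := ⟨m - (i + 2), by omega⟩
  exact prodP_shift s _ hc hb i k le_rfl

theorem prodP_semi_pow {M : Type*} [Monoid M] (s : ℕ → M) (m : ℕ)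
    (hc : ∀ i j, i + 2 ≤ j → j < m → s i * s j = s j * s i)
    (hb : ∀ i, i + 1 < m → s i * s (i + 1) * s i = s (i + 1) * s i * s (i + 1))
    (i k : ℕ) (hi : i + k < m) :
    SemiconjBy (prodP s m ^ k) (s i) (s (i + k)) := by
  induction k with
  | zero => simp
  | succ k ih =>
    rw [pow_succ']
    exact (prodP_semi s m hc hb (i + k) (by omega)).mul_left (ih (by omega))

theorem prodP_semi_prod {M : Type*} [Monoid M] (s : ℕ → M) (m : ℕ)
    (hc : ∀ i j, i + 2 ≤ j → j < m → s i * s j = s j * s i)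
    (hb : ∀ i, i + 1 < m → s i * s (i + 1) * s i = s (i + 1) * s i * s (i + 1))
    (k : ℕ) (hk : k + 1 ≤ m) :
    SemiconjBy (prodP s m) (prodP s k) (prodP (fun i => s (i + 1)) k) := by
  induction k with
  | zero => simp [prodP]
  | succ k ih => exact (ih (by omega)).mul_right (prodP_semi s m hc hb k (by omega))

theorem prodP_sq {M : Type*} [Monoid M] (s : ℕ → M) (m : ℕ)
    (hc : ∀ i j, i + 2 ≤ j → j < m → s i * s j = s j * s i)
    (hb : ∀ i, i + 1 < m → s i * s (i + 1) * s i = s (i + 1) * s i * s (i + 1))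
    (l : ℕ) (hl : m = l + 1) : SemiconjBy (prodP s m ^ 2) (s l) (s 0) := by
  have h := prodP_semi_prod s m hc hb l (by omega)
  have h1 : prodP s m = prodP s l * s l := by rw [hl]; rfl
  have h2 : prodP s m = s 0 * prodP (fun i => s (i + 1)) l := by rw [hl, prodP_succ_left]
  have h3 : prodP s m * prodP s m = prodP (fun i => s (i + 1)) l * prodP s m * s l := by
    rw [← h.eq, mul_assoc, ← h1]
  change prodP s m ^ 2 * s l = s 0 * prodP s m ^ 2
  rw [pow_two]
  nth_rw 2 [h3]
  rw [← mul_assoc, ← mul_assoc, ← h2]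

theorem prodP_central {M : Type*} [Monoid M] (s : ℕ → M) (m : ℕ)
    (hc : ∀ i j, i + 2 ≤ j → j < m → s i * s j = s j * s i)
    (hb : ∀ i, i + 1 < m → s i * s (i + 1) * s i = s (i + 1) * s i * s (i + 1))
    (i : ℕ) (hi : i < m) : SemiconjBy (prodP s m ^ (m + 1)) (s i) (s i) := by
  obtain ⟨l, rfl⟩ : ∃ l, m = i + l + 1 := ⟨m - i - 1, by omega⟩
  have h1 := prodP_semi_pow s _ hc hb i l (by omega)
  have h2 := prodP_sq s _ hc hb (i + l) rfl
  have h3 := prodP_semi_pow s _ hc hb 0 i (by omega)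
  have h := (h3.mul_left h2).mul_left h1
  rw [← pow_add, ← pow_add, zero_add] at h
  rwa [show i + 2 + l = i + l + 1 + 1 by omega] at h

theorem prodP_step {M : Type*} [Monoid M] (s : ℕ → M) (m : ℕ)
    (hc : ∀ i j, i + 2 ≤ j → j < m → s i * s j = s j * s i)
    (k : ℕ) (hk : k + 1 < m) :
    prodP s (k + 2) * prodP s (k + 1) = prodP s (k + 1) * prodP s k * (s (k + 1) * s k) := by
  have : prodP s (k + 2) = prodP s (k + 1) * s (k + 1) := rfl
  rw [this]
  nth_rw 2 [prodP]
  rw [mul_assoc, ← mul_assoc (s (k + 1)), ← prodP_comm s m hc k (k + 1) le_rfl hk]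
  simp only [mul_assoc]

theorem lkL_lkE (n : ℕ) (q t : ℂ) (i j k : ℕ) (hj : 1 ≤ j) (hjk : j < k) (hk : k ≤ n) :
    lkL n q t i (lkE n j k) = lkF n q t i j k := by
  have h : lkE n j k = Pi.basisFun ℂ (LKIdx n)
      ⟨(⟨j, by omega⟩, ⟨k, by omega⟩), hj, hjk⟩ := by
    ext p
    simp [lkE, Pi.single_apply, Subtype.ext_iff, Prod.ext_iff, Fin.ext_iff]
  rw [h, lkL, Module.Basis.constr_basis]

theorem lk_three (n : ℕ) (q t : ℂ) (k : ℕ) (hk : 1 ≤ k) (hn : k + 2 ≤ n) :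
    lkL n q t (k + 1) (lkL n q t k (lkE n (k + 1) (k + 2))) = q ^ 2 • lkE n k (k + 1) := by
  have e1 : lkF n q t k (k + 1) (k + 2) = q • lkE n k (k + 2) + (q ^ 2 - q) • lkE n k (k + 1)
      + (1 - q) • lkE n (k + 1) (k + 2) := by simp [lkF]
  have e2 : lkF n q t (k + 1) k (k + 2) = q • lkE n k (k + 1) + (1 - q) • lkE n k (k + 2)
      - ((q ^ 2 - q) * t) • lkE n (k + 1) (k + 2) := by
    unfold lkF
    rw [if_neg (by omega), if_neg (by omega), if_neg (by omega), if_pos (by omega)]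
  have e3 : lkF n q t (k + 1) k (k + 1) = lkE n k (k + 2) := by
    unfold lkF
    rw [if_neg (by omega), if_neg (by omega), if_neg (by omega), if_neg (by omega),
      if_pos (by omega)]
  have e4 : lkF n q t (k + 1) (k + 1) (k + 2) = (-(t * q ^ 2)) • lkE n (k + 1) (k + 2) := by
    unfold lkF
    rw [if_pos (by omega)]
  rw [lkL_lkE _ _ _ _ _ _ (by omega) (by omega) (by omega), e1]
  simp only [map_add, map_smul]
  rw [lkL_lkE _ _ _ _ _ _ (by omega) (by omega) (by omega),
    lkL_lkE _ _ _ _ _ _ (by omega) (by omega) (by omega),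
    lkL_lkE _ _ _ _ _ _ (by omega) (by omega) (by omega), e2, e3, e4]
  module

theorem lk_gen_rel (n : ℕ) (i j : Fin (n - 1)) :
    (((i : ℕ) + 2 ≤ j) → braidGen n i * braidGen n j = braidGen n j * braidGen n i) ∧
    (((i : ℕ) + 1 = j) → braidGen n i * braidGen n j * braidGen n i =
      braidGen n j * braidGen n i * braidGen n j) := by
  constructor
  · intro h
    have := PresentedGroup.one_of_mem (rels := braidRelsSet (n - 1))
      (x := FreeGroup.of i * FreeGroup.of j * (FreeGroup.of i)⁻¹ * (FreeGroup.of j)⁻¹)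
      ⟨i, j, Or.inl ⟨Or.inl h, rfl⟩⟩
    simp only [map_mul, map_inv] at this
    rw [mul_inv_eq_one, mul_inv_eq_iff_eq_mul] at this
    exact this
  · intro h
    have := PresentedGroup.one_of_mem (rels := braidRelsSet (n - 1))
      (x := FreeGroup.of i * FreeGroup.of j * FreeGroup.of i *
            (FreeGroup.of j * FreeGroup.of i * FreeGroup.of j)⁻¹)
      ⟨i, j, Or.inr ⟨Or.inl h, rfl⟩⟩
    rw [map_mul, map_inv, mul_inv_eq_one] at this
    simp only [map_mul] at this
    exact this

theorem lk_prodP_shift (n : ℕ) (q t : ℂ) (k m : ℕ) (hk : k + 2 ≤ m) (hm : m + 1 ≤ n) :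
    prodP (M := Module.End ℂ (LKIdx n → ℂ)) (fun i => lkL n q t (i + 1)) m
      (lkE n (k + 1) (k + 2)) = lkE n (k + 2) (k + 3) := by
  obtain ⟨d, rfl⟩ : ∃ d, m = k + 2 + d := ⟨m - (k + 2), by omega⟩
  induction d with
  | zero =>
    simp only [Nat.add_zero, prodP, Module.End.mul_apply]
    have e1 : lkF n q t (k + 1 + 1) (k + 1) (k + 2) = lkE n (k + 1) (k + 3) := by
      unfold lkF
      rw [if_neg (by omega), if_neg (by omega), if_neg (by omega), if_neg (by omega),
        if_pos (by omega)]
    have e2 : lkF n q t (k + 1) (k + 1) (k + 3) = lkE n (k + 2) (k + 3) := by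
      unfold lkF
      rw [if_neg (by omega), if_neg (by omega), if_pos (by omega)]
    rw [lkL_lkE _ _ _ _ _ _ (by omega) (by omega) (by omega), e1,
      lkL_lkE _ _ _ _ _ _ (by omega) (by omega) (by omega), e2]
    have h : ∀ r, r ≤ k → prodP (M := Module.End ℂ (LKIdx n → ℂ))
        (fun i => lkL n q t (i + 1)) r (lkE n (k + 2) (k + 3)) = lkE n (k + 2) (k + 3) := by
      intro r
      induction r with
      | zero => intro _; simp [prodP]
      | succ r ih =>
        intro hr
        rw [prodP, Module.End.mul_apply, lkL_lkE _ _ _ _ _ _ (by omega) (by omega) (by omega)]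
        have e3 : lkF n q t (r + 1) (k + 2) (k + 3) = lkE n (k + 2) (k + 3) := by
          unfold lkF
          rw [if_neg (by omega), if_neg (by omega), if_neg (by omega), if_neg (by omega),
            if_neg (by omega)]
        rw [e3, ih (by omega)]
    exact h k le_rfl
  | succ d ih =>
    have e3 : lkF n q t (k + 2 + d + 1) (k + 1) (k + 2) = lkE n (k + 1) (k + 2) := by
      unfold lkF
      rw [if_neg (by omega), if_neg (by omega), if_neg (by omega), if_neg (by omega),
        if_neg (by omega)]
    rw [← Nat.add_assoc, prodP, Module.End.mul_apply,
      lkL_lkE _ _ _ _ _ _ (by omega) (by omega) (by omega), e3]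
    exact ih (by omega) (by omega)

/-- Under the Lawrence–Krammer representation, the full twist `Δ²` is sent to
the scalar transformation `q^{2n} t² • id`. -/
theorem lawrence_krammer_fullTwist (n : ℕ) (hn : 2 ≤ n)
    (q t : ℂ) (hq : q ≠ 0) (ht : t ≠ 0)
    (ℒ : BraidGroup n →* LinearMap.GeneralLinearGroup ℂ (LKIdx n → ℂ))
    (hℒ : ∀ i : Fin (n - 1),
      ((ℒ (braidGen n i) : (LKIdx n → ℂ) →ₗ[ℂ] (LKIdx n → ℂ))) = lkL n q t ((i : ℕ) + 1)) :
    ((ℒ (fullTwist n) : (LKIdx n → ℂ) →ₗ[ℂ] (LKIdx n → ℂ)))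
      = (q ^ (2 * n) * t ^ 2) • (LinearMap.id : (LKIdx n → ℂ) →ₗ[ℂ] (LKIdx n → ℂ)) := by
  obtain ⟨m, rfl⟩ : ∃ m, n = m + 1 := ⟨n - 1, by omega⟩
  set s : ℕ → Module.End ℂ (LKIdx (m + 1) → ℂ) := fun i => lkL (m + 1) q t (i + 1) with hs
  have hg : ∀ i : Fin (m + 1 - 1), ((ℒ (braidGen (m + 1) i)).val) = s i := hℒ
  have hc : ∀ i j, i + 2 ≤ j → j < m → s i * s j = s j * s i := by
    intro i j hij hj
    have h := congrArg (fun x => (ℒ x).val) ((lk_gen_rel (m + 1) ⟨i, by omega⟩ ⟨j, by omega⟩).1 hij)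
    simp only [map_mul, Units.val_mul, hg] at h
    exact h
  have hb : ∀ i, i + 1 < m → s i * s (i + 1) * s i = s (i + 1) * s i * s (i + 1) := by
    intro i hi
    have h := congrArg (fun x => (ℒ x).val)
      ((lk_gen_rel (m + 1) ⟨i, by omega⟩ ⟨i + 1, by omega⟩).2 rfl)
    simp only [map_mul, Units.val_mul, hg] at h
    exact h
  have hT : (ℒ (fullTwist (m + 1))).val = prodP s m ^ (m + 1) := by
    rw [fullTwist, map_pow, Units.val_pow_eq_pow_val, map_list_prod, ← Units.coeHom_apply,
      map_list_prod, List.map_ofFn, List.map_ofFn, ← prodP_ofFn]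
    congr 3
    ext1 i
    exact hg i
  have hcent := prodP_central s m hc hb
  have hP : ∀ k, k < m → (prodP s (k + 1) * prodP s k) (lkE (m + 1) (k + 1) (k + 2)) =
      (-(t * q ^ (2 * k + 2))) • lkE (m + 1) 1 2 := by
    intro k
    induction k with
    | zero =>
      intro hk
      simp only [prodP, mul_one, one_mul, hs]
      rw [lkL_lkE _ _ _ _ _ _ (by omega) (by omega) (by omega)]
      simp [lkF]
    | succ k ih =>
      intro hk
      rw [prodP_step s m hc k hk, Module.End.mul_apply, Module.End.mul_apply (s (k + 1))]
      simp only [hs]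
      rw [lk_three (m + 1) q t (k + 1) (by omega) (by omega), map_smul, ← hs, ih (by omega),
        smul_smul]
      congr 1
      ring
  have hshift : ∀ k, k + 1 ≤ m → (prodP s m ^ k) (lkE (m + 1) 1 2) =
      lkE (m + 1) (k + 1) (k + 2) := by
    intro k
    induction k with
    | zero => intro _; simp
    | succ k ih =>
      intro hk
      rw [pow_succ', Module.End.mul_apply, ih (by omega)]
      exact lk_prodP_shift (m + 1) q t k m (by omega) le_rfl
  obtain ⟨l, rfl⟩ : ∃ l, m = l + 1 := ⟨m - 1, by omega⟩
  set c := q ^ (2 * (l + 1 + 1)) * t ^ 2 with hcdef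
  have h12 : (prodP s (l + 1) ^ (l + 1 + 1)) (lkE (l + 1 + 1) 1 2) = c • lkE (l + 1 + 1) 1 2 := by
    have e : prodP s (l + 1) ^ (l + 1 + 1) =
        prodP s (l + 1) * prodP s l * s l * prodP s (l + 1) ^ l := by
      rw [mul_assoc (prodP s (l + 1)), ← prodP, ← pow_two, ← pow_add]
      congr 1
      omega
    rw [e, Module.End.mul_apply, hshift l le_rfl, Module.End.mul_apply]
    simp only [hs]
    rw [lkL_lkE _ _ _ _ _ _ (by omega) (by omega) (by omega)]
    have e4 : lkF (l + 1 + 1) q t (l + 1) (l + 1) (l + 2) =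
        (-(t * q ^ 2)) • lkE (l + 1 + 1) (l + 1) (l + 2) := by
      unfold lkF
      rw [if_pos (by omega)]
    rw [e4, map_smul, ← hs, hP l (by omega), smul_smul, hcdef]
    congr 1
    ring
  have hprop : ∀ i, i < l + 1 → ∀ v, (prodP s (l + 1) ^ (l + 1 + 1)) v = c • v →
      (prodP s (l + 1) ^ (l + 1 + 1)) (s i v) = c • s i v := by
    intro i hi v hv
    rw [← Module.End.mul_apply, (hcent i hi).eq, Module.End.mul_apply, hv, map_smul]
  have h1k : ∀ k, k + 2 ≤ l + 2 → (prodP s (l + 1) ^ (l + 1 + 1)) (lkE (l + 1 + 1) 1 (k + 2)) =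
      c • lkE (l + 1 + 1) 1 (k + 2) := by
    intro k
    induction k with
    | zero => intro _; exact h12
    | succ k ih =>
      intro hk
      have e : s (k + 1) (lkE (l + 1 + 1) 1 (k + 2)) = lkE (l + 1 + 1) 1 (k + 1 + 2) := by
        simp only [hs]
        rw [lkL_lkE _ _ _ _ _ _ (by omega) (by omega) (by omega)]
        unfold lkF
        rw [if_neg (by omega), if_neg (by omega), if_neg (by omega), if_neg (by omega),
          if_pos (by omega)]
      rw [← e]
      exact hprop _ (by omega) _ (ih (by omega))
  have hjk : ∀ j k, j + 1 < k → k ≤ l + 2 →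
      (prodP s (l + 1) ^ (l + 1 + 1)) (lkE (l + 1 + 1) (j + 1) k) =
      c • lkE (l + 1 + 1) (j + 1) k := by
    intro j k
    induction j with
    | zero =>
      intro h1 h2
      obtain ⟨k, rfl⟩ : ∃ k', k = k' + 2 := ⟨k - 2, by omega⟩
      exact h1k k h2
    | succ j ih =>
      intro h1 h2
      have e : s j (lkE (l + 1 + 1) (j + 1) k) = lkE (l + 1 + 1) (j + 1 + 1) k := by
        simp only [hs]
        rw [lkL_lkE _ _ _ _ _ _ (by omega) (by omega) (by omega)]
        unfold lkF
        rw [if_neg (by omega), if_neg (by omega), if_pos (by omega)]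
      rw [← e]
      exact hprop _ (by omega) _ (ih (by omega) h2)
  rw [hT]
  refine (Pi.basisFun ℂ (LKIdx (l + 1 + 1))).ext ?_
  rintro ⟨⟨a, b⟩, h1, h2⟩
  have e : Pi.basisFun ℂ (LKIdx (l + 1 + 1)) ⟨(a, b), h1, h2⟩ = lkE (l + 1 + 1) a b := by
    ext p
    simp [lkE, Pi.single_apply, Subtype.ext_iff, Prod.ext_iff, Fin.ext_iff]
  rw [e]
  simp only at h1 h2
  obtain ⟨j, hj⟩ : ∃ j, (a : ℕ) = j + 1 := ⟨(a : ℕ) - 1, by omega⟩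
  rw [hj]
  exact hjk j b (by omega) (by have := b.2; omega)
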